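/- Let V₁, V₂ ∈ 𝒢_c(ℝⁿ) be such that 0 ∉ Σ_g(V₁) + Σ_g(V₂), i.e., ξ + η ≠ 0 whenever ξ ∈ Σ_g(V₁) and η ∈ Σ_g(V₂). Then Σ_g(V₁ V₂) ⊆ (Σ_g(V₁) + Σ_g(V₂)) ∪ Σ_g(V₁) ∪ Σ_g(V₂), where V₁V₂ denotes the product in the Colombeau algebra (induced by pointwise multiplication of representatives). -/

import Mathlib

open MeasureTheory RealInnerProductSpace Pointwise

noncomputable section

/-- `A_q(ℝ)` -/
def Aone (q : ℕ) : Set (ℝ → ℝ) :=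
  {φ | ContDiff ℝ (⊤ : ℕ∞) φ ∧ HasCompactSupport φ ∧ (∫ x : ℝ, φ x) = 1 ∧
    ∀ j : ℕ, 1 ≤ j → j ≤ q → (∫ x : ℝ, x ^ j * φ x) = 0}

/-- tensor power -/
def tensPow (n : ℕ) (φ : ℝ → ℝ) : EuclideanSpace ℝ (Fin n) → ℝ := fun x => ∏ i, φ (x i)

/-- `A_q(ℝⁿ)` -/
def Aset (n q : ℕ) : Set (EuclideanSpace ℝ (Fin n) → ℝ) :=
  {Φ | ∃ φ ∈ Aone q, Φ = tensPow n φ}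

/-- `φ_ε` -/
def scal (n : ℕ) (Φ : EuclideanSpace ℝ (Fin n) → ℝ) (ε : ℝ) :
    EuclideanSpace ℝ (Fin n) → ℝ := fun x => (ε ^ n)⁻¹ * Φ (ε⁻¹ • x)

/-- `ℰ_M(Ω)`: moderate families. -/
def Moderate (n : ℕ) (Ω : Set (EuclideanSpace ℝ (Fin n)))
    (R : (EuclideanSpace ℝ (Fin n) → ℝ) → EuclideanSpace ℝ (Fin n) → ℂ) : Prop :=
  (∀ Φ ∈ Aset n 0, ContDiffOn ℝ (⊤ : ℕ∞) (R Φ) Ω) ∧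
  ∀ K : Set (EuclideanSpace ℝ (Fin n)), K ⊆ Ω → IsCompact K → ∀ k : ℕ, ∃ N : ℕ,
    ∀ Φ ∈ Aset n N, ∃ c : ℝ, 0 < c ∧ ∃ η : ℝ, 0 < η ∧
      ∀ ε : ℝ, 0 < ε → ε < η → ∀ x ∈ K,
        ‖iteratedFDerivWithin ℝ k (R (scal n Φ ε)) Ω x‖ ≤ c * ε ^ (-(N : ℤ))

/-- `𝒩(Ω)`: negligible families. -/
def NullF (n : ℕ) (Ω : Set (EuclideanSpace ℝ (Fin n)))
    (R : (EuclideanSpace ℝ (Fin n) → ℝ) → EuclideanSpace ℝ (Fin n) → ℂ) : Prop :=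
  Moderate n Ω R ∧
  ∀ K : Set (EuclideanSpace ℝ (Fin n)), K ⊆ Ω → IsCompact K → ∀ k : ℕ, ∀ q : ℕ,
    ∃ p : ℕ, ∀ Φ ∈ Aset n p, ∃ c : ℝ, 0 < c ∧ ∃ η : ℝ, 0 < η ∧
      ∀ ε : ℝ, 0 < ε → ε < η → ∀ x ∈ K,
        ‖iteratedFDerivWithin ℝ k (R (scal n Φ ε)) Ω x‖ ≤ c * ε ^ q

/-- The Colombeau algebra `𝒢(Ω) = ℰ_M(Ω)/𝒩(Ω)`. -/
def GenF (n : ℕ) (Ω : Set (EuclideanSpace ℝ (Fin n))) :=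
  Quot (fun R S : {R : (EuclideanSpace ℝ (Fin n) → ℝ) → EuclideanSpace ℝ (Fin n) → ℂ //
      Moderate n Ω R} => NullF n Ω (fun Φ x => R.1 Φ x - S.1 Φ x))

/-- `R` is a representative of the class `U ∈ 𝒢(Ω)`. -/
def isRep (n : ℕ) (Ω : Set (EuclideanSpace ℝ (Fin n))) (U : GenF n Ω)
    (R : (EuclideanSpace ℝ (Fin n) → ℝ) → EuclideanSpace ℝ (Fin n) → ℂ) : Prop :=
  ∃ h : Moderate n Ω R, Quot.mk _ ⟨R, h⟩ = U

/-- `R` is supported in one fixed compact subset of `Ω`. -/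
def cptSupp (n : ℕ) (Ω : Set (EuclideanSpace ℝ (Fin n)))
    (R : (EuclideanSpace ℝ (Fin n) → ℝ) → EuclideanSpace ℝ (Fin n) → ℂ) : Prop :=
  ∃ K : Set (EuclideanSpace ℝ (Fin n)), IsCompact K ∧ K ⊆ Ω ∧
    ∀ Φ ∈ Aset n 0, ∀ x ∉ K, R Φ x = 0

/-- `U ∈ 𝒢_c(Ω)`. -/
def cptClass (n : ℕ) (Ω : Set (EuclideanSpace ℝ (Fin n))) (U : GenF n Ω) : Prop :=
  ∃ R, isRep n Ω U R ∧ cptSupp n Ω R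

/-- Fourier transform `∫_Ω e^{-ix·ξ} f(x) dx` (for compactly supported `f`, extended
by zero outside `Ω`). -/
def FTC (n : ℕ) (Ω : Set (EuclideanSpace ℝ (Fin n))) (f : EuclideanSpace ℝ (Fin n) → ℂ)
    (ξ : EuclideanSpace ℝ (Fin n)) : ℂ :=
  ∫ x in Ω, Complex.exp (-Complex.I * (⟪x, ξ⟫ : ℝ)) * f x

/-- an open cone in `ℝⁿ \ {0}`. -/
def IsOpenCone (n : ℕ) (Γ : Set (EuclideanSpace ℝ (Fin n))) : Prop :=
  IsOpen Γ ∧ (0 : EuclideanSpace ℝ (Fin n)) ∉ Γ ∧ ∀ ξ ∈ Γ, ∀ t : ℝ, 0 < t → t • ξ ∈ Γ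

/-- rapid decrease of order `ε^{-N}` of the regularized Fourier transforms on `Γ`. -/
def rapidDecOn (n : ℕ) (Ω : Set (EuclideanSpace ℝ (Fin n)))
    (R : (EuclideanSpace ℝ (Fin n) → ℝ) → EuclideanSpace ℝ (Fin n) → ℂ)
    (Γ : Set (EuclideanSpace ℝ (Fin n))) (N : ℕ) : Prop :=
  ∀ p : ℕ, ∃ M : ℕ, ∀ Φ ∈ Aset n M, ∃ c : ℝ, 0 < c ∧ ∃ ε₀ : ℝ, 0 < ε₀ ∧
    ∀ ε : ℝ, 0 < ε → ε < ε₀ → ∀ ξ ∈ Γ,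
      ‖FTC n Ω (R (scal n Φ ε)) ξ‖ ≤ c * ε ^ (-(N : ℤ)) * (1 + ‖ξ‖) ^ (-(p : ℤ))

/-- `Σ_g(U)` for `U ∈ 𝒢_c(Ω)`: `ξ₀ ∉ Σ_g(U)` iff `ξ₀ = 0` or for some compactly
supported representative the regularized Fourier transforms are rapidly decreasing on
an open conic neighborhood of `ξ₀`. -/
def SigmaG (n : ℕ) (Ω : Set (EuclideanSpace ℝ (Fin n))) (U : GenF n Ω) :
    Set (EuclideanSpace ℝ (Fin n)) :=
  {ξ₀ | ξ₀ ≠ 0 ∧ ¬ ∃ R, isRep n Ω U R ∧ cptSupp n Ω R ∧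
    ∃ Γ, IsOpenCone n Γ ∧ ξ₀ ∈ Γ ∧ ∃ N : ℕ, rapidDecOn n Ω R Γ N}

end

local notation "𝔼" n:max => EuclideanSpace ℝ (Fin n)

section FourierEstimates

open FourierTransform

variable {n : ℕ}

lemma FTC_univ_eq_fourier (f : 𝔼 n → ℂ) (ξ : 𝔼 n) :
    FTC n Set.univ f ξ = 𝓕 f ((2 * Real.pi)⁻¹ • ξ) := by
  rw [FTC, Real.fourier_eq', setIntegral_univ]
  congr 1 with x
  rw [smul_eq_mul, inner_smul_right]
  congr 2
  push_cast
  have : (Real.pi : ℂ) ≠ 0 := by exact_mod_cast Real.pi_ne_zero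
  field_simp

lemma FTC_univ_sub {f g : 𝔼 n → ℂ} (hf : Integrable f) (hg : Integrable g) (ξ : 𝔼 n) :
    FTC n Set.univ (fun x => f x - g x) ξ = FTC n Set.univ f ξ - FTC n Set.univ g ξ := by
  simp only [FTC_univ_eq_fourier, Real.fourier_eq]
  rw [← integral_sub]
  · simp only [smul_sub]
  · exact (Real.fourierIntegral_convergent_iff _).2 hf
  · exact (Real.fourierIntegral_convergent_iff _).2 hg

/-- Exchange formula for the Fourier transform of a product of test functions. -/
lemma norm_FTC_mul_le {f g : 𝔼 n → ℂ} (hf : ContDiff ℝ (⊤ : ℕ∞) f) (hf' : HasCompactSupport f)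
    (hg : ContDiff ℝ (⊤ : ℕ∞) g) (hg' : HasCompactSupport g) (ξ : 𝔼 n) :
    ‖FTC n Set.univ (fun x => f x * g x) ξ‖ ≤
      ∫ η : 𝔼 n, ‖FTC n Set.univ f (ξ + (2 * Real.pi) • η)‖ *
        ‖FTC n Set.univ g (-((2 * Real.pi) • η))‖ := by
  set w : 𝔼 n := (2 * Real.pi)⁻¹ • ξ with hw
  let G := hg'.toSchwartzMap hg
  let h : SchwartzMap (𝔼 n) ℂ := 𝓕⁻ G
  have hfi : Integrable f := hf.continuous.integrable_of_hasCompactSupport hf'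
  have hGh : ∀ x, g x = 𝓕 (h : 𝔼 n → ℂ) x := fun x => by
    have : 𝓕 h = G := by simp [h]
    rw [← SchwartzMap.fourier_coe, this]; rfl
  have hh : ∀ η, h η = 𝓕 g (-η) := fun η => by
    have : h η = 𝓕⁻ (G : 𝔼 n → ℂ) η := by rw [← SchwartzMap.fourierInv_coe]
    rw [this, Real.fourierInv_eq_fourier_neg]; rfl
  have h2π : (2 * Real.pi) ≠ 0 := by positivity
  have hmod : Integrable (fun x : 𝔼 n => (Real.fourierChar (-⟪x, w⟫)) • f x) :=
    (Real.fourierIntegral_convergent_iff _).2 hfi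
  have key : FTC n Set.univ (fun x => f x * g x) ξ
      = ∫ η : 𝔼 n, 𝓕 f (η + w) * 𝓕 g (-η) := by
    have := VectorFourier.integral_fourierIntegral_smul_eq_flip (L := innerₗ (𝔼 n))
      (μ := volume) (ν := volume) Real.continuous_fourierChar continuous_inner hmod
      h.integrable
    rw [flip_innerₗ] at this
    rw [FTC_univ_eq_fourier, Real.fourier_eq, ← hw]
    trans ∫ x : 𝔼 n, (Real.fourierChar (-⟪x, w⟫) • f x) • 𝓕 (h : 𝔼 n → ℂ) x
    · congr 1 with x
      rw [hGh x, smul_eq_mul, smul_mul_assoc]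
    · refine this.symm.trans ?_
      congr 1 with η
      rw [← hh η, smul_eq_mul]
      congr 1
      rw [Real.fourier_eq]
      simp only [VectorFourier.fourierIntegral]
      congr 1 with x
      rw [smul_smul, ← AddChar.map_add_eq_mul]
      congr 2
      simp [inner_add_right]
      ring
  rw [key]
  refine (norm_integral_le_integral_norm _).trans (le_of_eq ?_)
  congr 1 with η
  rw [norm_mul, FTC_univ_eq_fourier, FTC_univ_eq_fourier, smul_add, smul_neg, smul_smul,
    inv_mul_cancel₀ h2π, one_smul, add_comm, ← hw]

lemma one_add_pow_le_two_pow_mul {x : ℝ} (hx : 0 ≤ x) (p : ℕ) :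
    (1 + x) ^ p ≤ 2 ^ p * (1 + x ^ p) := by
  have h : 1 + x ≤ 2 * max 1 x := by
    rw [two_mul]; exact add_le_add (le_max_left _ _) (le_max_right _ _)
  refine (pow_le_pow_left₀ (by positivity) h p).trans ?_
  rw [mul_pow]
  gcongr
  rcases le_total 1 x with h' | h'
  · rw [max_eq_right h']; linarith
  · rw [max_eq_left h', one_pow]; linarith [pow_nonneg hx p]

/-- The weighted Fourier transform of a function supported in a compact set is controlled by
its derivatives on this set. -/
lemma exists_norm_FTC_mul_pow_le {K : Set (𝔼 n)} (hK : IsCompact K) (p : ℕ) :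
    ∃ C : ℝ, 0 < C ∧ ∀ f : 𝔼 n → ℂ, ContDiff ℝ (⊤ : ℕ∞) f → (∀ x ∉ K, f x = 0) →
      ∀ B : ℝ, 0 ≤ B → (∀ k ∈ Finset.range (p + 1), ∀ x ∈ K, ‖iteratedFDeriv ℝ k f x‖ ≤ B) →
      ∀ ξ : 𝔼 n, ‖FTC n Set.univ f ξ‖ * (1 + ‖ξ‖) ^ p ≤ C * B := by
  set m : ℝ := volume.real K
  have hm : 0 ≤ m := measureReal_nonneg
  refine ⟨2 ^ p * (m + (2 * Real.pi) ^ p * (2 ^ p * ((p + 1) * m))) + 1, by positivity, ?_⟩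
  intro f hf hfK B hB hfB ξ
  have hsupp : tsupport f ⊆ K :=
    closure_minimal (fun x hx => by_contra fun h => hx (hfK x h)) hK.isClosed
  have hcont : ∀ k, Continuous fun x => ‖iteratedFDeriv ℝ k f x‖ := fun k =>
    (hf.continuous_iteratedFDeriv (by exact_mod_cast le_top)).norm
  have hzero : ∀ k, ∀ x ∉ K, ‖iteratedFDeriv ℝ k f x‖ = 0 := fun k x hx => by
    rw [norm_eq_zero]
    by_contra h
    exact hx (hsupp (support_iteratedFDeriv_subset k h))
  have hint : ∀ k ∈ Finset.range (p + 1), ∫ x, ‖iteratedFDeriv ℝ k f x‖ ≤ m * B := fun k hk => by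
    rw [← setIntegral_eq_integral_of_forall_compl_eq_zero (hzero k)]
    have h : ∫ x in K, ‖iteratedFDeriv ℝ k f x‖ ≤ ∫ _x in K, B :=
      setIntegral_mono_on ((hcont k).continuousOn.integrableOn_compact hK)
        (integrableOn_const hK.measure_lt_top.ne) hK.measurableSet (hfB k hk)
    simpa using h
  have hinteg : ∀ i k : ℕ, Integrable fun v => ‖v‖ ^ i * ‖iteratedFDeriv ℝ k f v‖ := fun i k => by
    refine ((continuous_norm.pow i).mul (hcont k)).integrable_of_hasCompactSupport
      (HasCompactSupport.intro hK fun x hx => ?_)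
    exact mul_eq_zero_of_right _ (hzero k x hx)
  set w : 𝔼 n := (2 * Real.pi)⁻¹ • ξ with hw
  have h0 : ‖𝓕 f w‖ ≤ m * B := by
    have := hint 0 (by simp)
    simp only [norm_iteratedFDeriv_zero] at this
    exact (VectorFourier.norm_fourierIntegral_le_integral_norm _ _ _ _ _).trans this
  have hp : ‖w‖ ^ p * ‖𝓕 f w‖ ≤ 2 ^ p * ((p + 1) * m) * B := by
    have := Real.pow_mul_norm_iteratedFDeriv_fourier_le (K := ⊤) (N := ⊤) hf
      (fun k l _ _ => hinteg k l) (k := 0) (n := p) le_top le_top w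
    rw [norm_iteratedFDeriv_zero] at this
    refine this.trans ?_
    have hs : ∑ q ∈ Finset.range (0 + 1) ×ˢ Finset.range (p + 1),
        ∫ v, ‖v‖ ^ q.1 * ‖iteratedFDeriv ℝ q.2 f v‖ ≤ (p + 1) * (m * B) := by
      rw [Finset.sum_product]
      simp only [zero_add, Finset.sum_range_one, pow_zero, one_mul]
      refine (Finset.sum_le_sum hint).trans (le_of_eq ?_)
      simp
    simp only [pow_zero, one_mul, Nat.cast_zero, mul_zero, zero_add] at hs ⊢
    calc (2 : ℝ) ^ p * _ ≤ 2 ^ p * ((p + 1) * (m * B)) := by gcongr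
      _ = _ := by ring
  have hξ : ‖ξ‖ = 2 * Real.pi * ‖w‖ := by
    rw [hw, norm_smul, Real.norm_of_nonneg (by positivity)]
    field_simp
  rw [FTC_univ_eq_fourier, ← hw]
  calc ‖𝓕 f w‖ * (1 + ‖ξ‖) ^ p ≤ ‖𝓕 f w‖ * (2 ^ p * (1 + ‖ξ‖ ^ p)) := by
        gcongr; exact one_add_pow_le_two_pow_mul (norm_nonneg _) p
    _ = 2 ^ p * (‖𝓕 f w‖ + (2 * Real.pi) ^ p * (‖w‖ ^ p * ‖𝓕 f w‖)) := by
        rw [hξ, mul_pow]; ring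
    _ ≤ 2 ^ p * (m * B + (2 * Real.pi) ^ p * (2 ^ p * ((p + 1) * m) * B)) := by gcongr
    _ ≤ _ := by nlinarith

end FourierEstimates

section EpsBound

variable {n : ℕ} {X Y : Type*}

lemma Aone_mono {p q : ℕ} (h : p ≤ q) : Aone q ⊆ Aone p := fun _ hφ =>
  ⟨hφ.1, hφ.2.1, hφ.2.2.1, fun j hj hjp => hφ.2.2.2 j hj (hjp.trans h)⟩

lemma Aset_mono {p q : ℕ} (h : p ≤ q) : Aset n q ⊆ Aset n p := by
  rintro _ ⟨φ, hφ, rfl⟩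
  exact ⟨φ, Aone_mono h hφ, rfl⟩

lemma scal_mem_Aset {q : ℕ} {Φ : 𝔼 n → ℝ} (hΦ : Φ ∈ Aset n q) {ε : ℝ} (hε : 0 < ε) :
    scal n Φ ε ∈ Aset n 0 := by
  obtain ⟨φ, hφ, rfl⟩ := hΦ
  refine ⟨fun x => ε⁻¹ * φ (ε⁻¹ * x), ⟨?_, ?_, ?_, fun j hj hj0 => by omega⟩, ?_⟩
  · exact contDiff_const.mul (hφ.1.comp (contDiff_const.mul contDiff_id))
  · exact HasCompactSupport.mul_left
      (hφ.2.1.comp_homeomorph (Homeomorph.mulLeft₀ ε⁻¹ (inv_ne_zero hε.ne')))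
  · rw [integral_const_mul, Measure.integral_comp_mul_left, hφ.2.2.1, inv_inv, abs_of_pos hε]
    simp [hε.ne']
  · ext x
    simp [scal, tensPow, Finset.prod_mul_distrib]

/-- `g(φ_ε, x) = O(ε^m)` uniformly for `x ∈ S`, for all `φ` with sufficiently many vanishing
moments. -/
def EpsBound (S : Set X) (g : (𝔼 n → ℝ) → X → ℝ) (m : ℤ) : Prop :=
  ∃ M : ℕ, ∀ Φ ∈ Aset n M, ∃ c : ℝ, 0 < c ∧ ∃ η : ℝ, 0 < η ∧
    ∀ ε : ℝ, 0 < ε → ε < η → ∀ x ∈ S, g (scal n Φ ε) x ≤ c * ε ^ m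

namespace EpsBound

variable {S : Set X} {g g₁ g₂ : (𝔼 n → ℝ) → X → ℝ} {m m₁ m₂ : ℤ}

lemma of_le (hg : EpsBound S g m) {T : Set Y} {g' : (𝔼 n → ℝ) → Y → ℝ} {C : ℝ} (hC : 0 < C)
    (h : ∀ Ψ ∈ Aset n 0, ∀ y ∈ T, ∃ x ∈ S, g' Ψ y ≤ C * g Ψ x) : EpsBound T g' m := by
  obtain ⟨M, hM⟩ := hg
  refine ⟨M, fun Φ hΦ => ?_⟩
  obtain ⟨c, hc, η, hη, hb⟩ := hM Φ hΦ
  refine ⟨C * c, by positivity, η, hη, fun ε hε hεη y hy => ?_⟩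
  obtain ⟨x, hx, hxy⟩ := h _ (scal_mem_Aset hΦ hε) y hy
  rw [mul_assoc]
  exact hxy.trans (mul_le_mul_of_nonneg_left (hb ε hε hεη x hx) hC.le)

lemma mono_le (hg : EpsBound S g₂ m) (h : ∀ Ψ ∈ Aset n 0, ∀ x ∈ S, g₁ Ψ x ≤ g₂ Ψ x) :
    EpsBound S g₁ m :=
  hg.of_le one_pos fun Ψ hΨ x hx => ⟨x, hx, by simpa using h Ψ hΨ x hx⟩

lemma mono_exp (hg : EpsBound S g m) (h : m₁ ≤ m) : EpsBound S g m₁ := by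
  obtain ⟨M, hM⟩ := hg
  refine ⟨M, fun Φ hΦ => ?_⟩
  obtain ⟨c, hc, η, hη, hb⟩ := hM Φ hΦ
  refine ⟨c, hc, min η 1, by positivity, fun ε hε hεη x hx =>
    (hb ε hε (hεη.trans_le (min_le_left _ _)) x hx).trans ?_⟩
  exact mul_le_mul_of_nonneg_left
    (zpow_le_zpow_right_of_le_one₀ hε (hεη.le.trans (min_le_right _ _)) h) hc.le

lemma op {Z : Type*} {T : Set Y} {U : Set Z} {k : (𝔼 n → ℝ) → Y → ℝ} {l : (𝔼 n → ℝ) → Z → ℝ}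
    (hg : EpsBound S g m₁) (hk : EpsBound T k m₂)
    (h : ∀ c₁ > 0, ∀ c₂ > 0, ∃ c > 0, ∀ Ψ ∈ Aset n 0, ∀ ε : ℝ, 0 < ε →
      (∀ x ∈ S, g Ψ x ≤ c₁ * ε ^ m₁) → (∀ y ∈ T, k Ψ y ≤ c₂ * ε ^ m₂) →
        ∀ z ∈ U, l Ψ z ≤ c * ε ^ m) : EpsBound U l m := by
  obtain ⟨M₁, hM₁⟩ := hg
  obtain ⟨M₂, hM₂⟩ := hk
  refine ⟨max M₁ M₂, fun Φ hΦ => ?_⟩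
  obtain ⟨c₁, hc₁, η₁, hη₁, hb₁⟩ := hM₁ Φ (Aset_mono (le_max_left _ _) hΦ)
  obtain ⟨c₂, hc₂, η₂, hη₂, hb₂⟩ := hM₂ Φ (Aset_mono (le_max_right _ _) hΦ)
  obtain ⟨c, hc, hb⟩ := h c₁ hc₁ c₂ hc₂
  exact ⟨c, hc, min η₁ η₂, by positivity, fun ε hε hεη => hb _ (scal_mem_Aset hΦ hε) ε hε
    (hb₁ ε hε (hεη.trans_le (min_le_left _ _))) (hb₂ ε hε (hεη.trans_le (min_le_right _ _)))⟩

lemma add (h₁ : EpsBound S g₁ m) (h₂ : EpsBound S g₂ m) :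
    EpsBound S (fun Ψ x => g₁ Ψ x + g₂ Ψ x) m :=
  h₁.op h₂ fun c₁ hc₁ c₂ hc₂ => ⟨c₁ + c₂, by positivity, fun Ψ _ ε _ hb₁ hb₂ x hx => by
    rw [add_mul]; exact add_le_add (hb₁ x hx) (hb₂ x hx)⟩

lemma mul (h₁ : EpsBound S g₁ m₁) (h₂ : EpsBound S g₂ m₂)
    (h : ∀ Ψ ∈ Aset n 0, ∀ x ∈ S, 0 ≤ g₁ Ψ x ∧ 0 ≤ g₂ Ψ x) :
    EpsBound S (fun Ψ x => g₁ Ψ x * g₂ Ψ x) (m₁ + m₂) :=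
  h₁.op h₂ fun c₁ hc₁ c₂ hc₂ => ⟨c₁ * c₂, by positivity, fun Ψ hΨ ε hε hb₁ hb₂ x hx => by
    rw [zpow_add₀ hε.ne', mul_mul_mul_comm]
    exact mul_le_mul (hb₁ x hx) (hb₂ x hx) (h Ψ hΨ x hx).2 (by positivity)⟩

lemma union {T : Set X} (h₁ : EpsBound S g m) (h₂ : EpsBound T g m) :
    EpsBound (S ∪ T) g m :=
  h₁.op h₂ fun c₁ hc₁ c₂ hc₂ => ⟨c₁ + c₂, by positivity, fun Ψ hΨ ε hε hb₁ hb₂ x hx => by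
    have : 0 < ε ^ m := by positivity
    rcases hx with hx | hx
    · exact (hb₁ x hx).trans (by gcongr; linarith)
    · exact (hb₂ x hx).trans (by gcongr; linarith)⟩

lemma of_nonpos (h : ∀ Ψ ∈ Aset n 0, ∀ x ∈ S, g Ψ x ≤ 0) : EpsBound S g m :=
  ⟨0, fun Φ hΦ => ⟨1, one_pos, 1, one_pos, fun ε hε _ x hx =>
    (h _ (scal_mem_Aset hΦ hε) x hx).trans (by positivity)⟩⟩

lemma sum {ι : Type*} (s : Finset ι) {f : ι → (𝔼 n → ℝ) → X → ℝ}
    (h : ∀ i ∈ s, EpsBound S (f i) m) : EpsBound S (fun Ψ x => ∑ i ∈ s, f i Ψ x) m := by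
  classical
  induction s using Finset.induction_on with
  | empty => exact of_nonpos fun _ _ _ _ => by simp
  | insert a s ha ih =>
    simp only [Finset.sum_insert ha]
    exact (h a (Finset.mem_insert_self _ _)).add
      (ih fun i hi => h i (Finset.mem_insert_of_mem hi))

lemma exists_common {ι : Type*} (s : Finset ι) {f : ι → (𝔼 n → ℝ) → X → ℝ}
    (h : ∀ i ∈ s, ∃ N : ℕ, EpsBound S (f i) (-(N : ℤ))) :
    ∃ N : ℕ, ∀ i ∈ s, EpsBound S (f i) (-(N : ℤ)) := by
  choose! N hN using h
  refine ⟨s.sup N, fun i hi => (hN i hi).mono_exp ?_⟩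
  have := Finset.le_sup (f := N) hi
  omega

end EpsBound

end EpsBound

section Representatives

variable {n : ℕ}

lemma moderate_univ_iff {R : (𝔼 n → ℝ) → 𝔼 n → ℂ} :
    Moderate n Set.univ R ↔ (∀ Φ ∈ Aset n 0, ContDiff ℝ (⊤ : ℕ∞) (R Φ)) ∧
      ∀ K : Set (𝔼 n), IsCompact K → ∀ k : ℕ, ∃ N : ℕ,
        EpsBound K (fun Ψ x => ‖iteratedFDeriv ℝ k (R Ψ) x‖) (-(N : ℤ)) := by
  simp only [Moderate, contDiffOn_univ, Set.subset_univ, true_imp_iff,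
    iteratedFDerivWithin_univ]
  refine and_congr_right fun _ => forall_congr' fun K => forall_congr' fun hK =>
    forall_congr' fun k => ⟨fun ⟨N, hN⟩ => ⟨N, N, hN⟩, ?_⟩
  rintro ⟨N, M, hM⟩
  refine ⟨max M N, fun Φ hΦ => ?_⟩
  obtain ⟨c, hc, η, hη, hb⟩ := hM Φ (Aset_mono (le_max_left _ _) hΦ)
  refine ⟨c, hc, min η 1, by positivity, fun ε hε hεη x hx =>
    (hb ε hε (hεη.trans_le (min_le_left _ _)) x hx).trans ?_⟩
  exact mul_le_mul_of_nonneg_left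
    (zpow_le_zpow_right_of_le_one₀ hε (hεη.le.trans (min_le_right _ _)) (by simp)) hc.le

lemma nullF_univ_iff {R : (𝔼 n → ℝ) → 𝔼 n → ℂ} :
    NullF n Set.univ R ↔ (∀ Φ ∈ Aset n 0, ContDiff ℝ (⊤ : ℕ∞) (R Φ)) ∧
      ∀ K : Set (𝔼 n), IsCompact K → ∀ k q : ℕ,
        EpsBound K (fun Ψ x => ‖iteratedFDeriv ℝ k (R Ψ) x‖) q := by
  have h : NullF n Set.univ R ↔ Moderate n Set.univ R ∧
      ∀ K : Set (𝔼 n), IsCompact K → ∀ k q : ℕ,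
        EpsBound K (fun Ψ x => ‖iteratedFDeriv ℝ k (R Ψ) x‖) q := by
    simp only [NullF, EpsBound, Set.subset_univ, true_imp_iff, iteratedFDerivWithin_univ,
      zpow_natCast]
  rw [h, moderate_univ_iff]
  exact ⟨fun h => ⟨h.1.1, h.2⟩, fun h => ⟨⟨h.1, fun K hK k => ⟨0, by simpa using h.2 K hK k 0⟩⟩,
    h.2⟩⟩

lemma NullF.zero : NullF n Set.univ fun _ _ => 0 := by
  refine nullF_univ_iff.2 ⟨fun _ _ => contDiff_const, fun K _ k q =>
    EpsBound.of_nonpos fun Ψ _ x _ => ?_⟩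
  have : iteratedFDeriv ℝ k (fun _ : 𝔼 n => (0 : ℂ)) = 0 := iteratedFDeriv_fun_zero
  simp [this]

lemma NullF.neg {R : (𝔼 n → ℝ) → 𝔼 n → ℂ} (hR : NullF n Set.univ R) :
    NullF n Set.univ fun Φ x => -R Φ x := by
  rw [nullF_univ_iff] at hR ⊢
  refine ⟨fun Φ hΦ => (hR.1 Φ hΦ).neg, fun K hK k q => (hR.2 K hK k q).mono_le fun Ψ hΨ x _ => ?_⟩
  have : (fun x => -R Ψ x) = -R Ψ := rfl
  rw [this, iteratedFDeriv_neg_apply, norm_neg]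

lemma NullF.add {R S : (𝔼 n → ℝ) → 𝔼 n → ℂ} (hR : NullF n Set.univ R)
    (hS : NullF n Set.univ S) : NullF n Set.univ fun Φ x => R Φ x + S Φ x := by
  rw [nullF_univ_iff] at hR hS ⊢
  refine ⟨fun Φ hΦ => (hR.1 Φ hΦ).add (hS.1 Φ hΦ), fun K hK k q =>
    ((hR.2 K hK k q).add (hS.2 K hK k q)).mono_le fun Ψ hΨ x _ => ?_⟩
  rw [fun_iteratedFDeriv_add_apply
    ((hR.1 Ψ hΨ).of_le (by exact_mod_cast le_top)).contDiffAt
    ((hS.1 Ψ hΨ).of_le (by exact_mod_cast le_top)).contDiffAt]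
  exact norm_add_le _ _

/-- Leibniz rule for uniform bounds of derivatives. -/
lemma EpsBound.iteratedFDeriv_mul {R S : (𝔼 n → ℝ) → 𝔼 n → ℂ}
    (hR : ∀ Φ ∈ Aset n 0, ContDiff ℝ (⊤ : ℕ∞) (R Φ))
    (hS : ∀ Φ ∈ Aset n 0, ContDiff ℝ (⊤ : ℕ∞) (S Φ)) {K : Set (𝔼 n)} {k : ℕ} {m₁ m₂ : ℤ}
    (hRk : ∀ i ∈ Finset.range (k + 1),
      EpsBound K (fun Ψ x => ‖iteratedFDeriv ℝ i (R Ψ) x‖) m₁)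
    (hSk : ∀ i ∈ Finset.range (k + 1),
      EpsBound K (fun Ψ x => ‖iteratedFDeriv ℝ i (S Ψ) x‖) m₂) :
    EpsBound K (fun Ψ x => ‖iteratedFDeriv ℝ k (fun x => R Ψ x * S Ψ x) x‖) (m₁ + m₂) := by
  refine (EpsBound.sum (Finset.range (k + 1)) (f := fun i Ψ x => (k.choose i : ℝ) *
      (‖iteratedFDeriv ℝ i (R Ψ) x‖ * ‖iteratedFDeriv ℝ (k - i) (S Ψ) x‖)) fun i hi => ?_).mono_le
    fun Ψ hΨ x _ => (norm_iteratedFDeriv_mul_le (hR Ψ hΨ) (hS Ψ hΨ) x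
      (by exact_mod_cast le_top)).trans (le_of_eq (by simp only [mul_assoc]))
  have hki : k - i ∈ Finset.range (k + 1) := Finset.mem_range.2 (by omega)
  have hpos : 0 < k.choose i := Nat.choose_pos (by simpa [Nat.lt_succ_iff] using hi)
  exact ((hRk i hi).mul (hSk _ hki) fun _ _ _ _ => ⟨norm_nonneg _, norm_nonneg _⟩).of_le
    (C := k.choose i) (by exact_mod_cast hpos) fun Ψ _ x hx => ⟨x, hx, le_rfl⟩

lemma Moderate.mul {R S : (𝔼 n → ℝ) → 𝔼 n → ℂ} (hR : Moderate n Set.univ R)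
    (hS : Moderate n Set.univ S) : Moderate n Set.univ fun Φ x => R Φ x * S Φ x := by
  rw [moderate_univ_iff] at hR hS ⊢
  refine ⟨fun Φ hΦ => (hR.1 Φ hΦ).mul (hS.1 Φ hΦ), fun K hK k => ?_⟩
  obtain ⟨N₁, h₁⟩ := EpsBound.exists_common (Finset.range (k + 1)) fun i _ => hR.2 K hK i
  obtain ⟨N₂, h₂⟩ := EpsBound.exists_common (Finset.range (k + 1)) fun i _ => hS.2 K hK i
  exact ⟨N₁ + N₂, (EpsBound.iteratedFDeriv_mul hR.1 hS.1 h₁ h₂).mono_exp (by push_cast; omega)⟩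

lemma NullF.mul_left {R S : (𝔼 n → ℝ) → 𝔼 n → ℂ} (hR : Moderate n Set.univ R)
    (hS : NullF n Set.univ S) : NullF n Set.univ fun Φ x => R Φ x * S Φ x := by
  rw [moderate_univ_iff] at hR
  rw [nullF_univ_iff] at hS ⊢
  refine ⟨fun Φ hΦ => (hR.1 Φ hΦ).mul (hS.1 Φ hΦ), fun K hK k q => ?_⟩
  obtain ⟨N, h₁⟩ := EpsBound.exists_common (Finset.range (k + 1)) fun i _ => hR.2 K hK i
  exact (EpsBound.iteratedFDeriv_mul hR.1 hS.1 h₁ fun i _ => hS.2 K hK i (q + N)).mono_exp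
    (by push_cast; omega)

lemma isRep.nullF_sub {U : GenF n Set.univ} {R S : (𝔼 n → ℝ) → 𝔼 n → ℂ}
    (hR : isRep n Set.univ U R) (hS : isRep n Set.univ U S) :
    NullF n Set.univ fun Φ x => R Φ x - S Φ x := by
  obtain ⟨hR, rfl⟩ := hR
  obtain ⟨hS, h⟩ := hS
  have key : ∀ A B : {R : (𝔼 n → ℝ) → 𝔼 n → ℂ // Moderate n Set.univ R},
      Relation.EqvGen (fun A B : {R : (𝔼 n → ℝ) → 𝔼 n → ℂ // Moderate n Set.univ R} =>
        NullF n Set.univ fun Φ x => A.1 Φ x - B.1 Φ x) A B →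
      NullF n Set.univ fun Φ x => A.1 Φ x - B.1 Φ x := by
    intro A B hAB
    induction hAB with
    | rel _ _ h => exact h
    | refl A => simpa using NullF.zero
    | symm _ _ _ ih => simpa using ih.neg
    | trans _ _ _ _ _ ih₁ ih₂ => simpa using ih₁.add ih₂
  exact key ⟨R, hR⟩ ⟨S, hS⟩ (Quot.eqvGen_exact h.symm)

lemma isRep.of_nullF_sub {U : GenF n Set.univ} {R S : (𝔼 n → ℝ) → 𝔼 n → ℂ}
    (hR : isRep n Set.univ U R) (hS : Moderate n Set.univ S)
    (h : NullF n Set.univ fun Φ x => R Φ x - S Φ x) : isRep n Set.univ U S := by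
  obtain ⟨hR, rfl⟩ := hR
  exact ⟨hS, Eq.symm (Quot.sound h)⟩

/-- The class of a product does not depend on the representatives of the factors. -/
lemma isRep.mul_congr {V₁ V₂ W : GenF n Set.univ} {u₁ u₂ v₁ v₂ : (𝔼 n → ℝ) → 𝔼 n → ℂ}
    (hu₁ : isRep n Set.univ V₁ u₁) (hu₂ : isRep n Set.univ V₂ u₂)
    (hv₁ : isRep n Set.univ V₁ v₁) (hv₂ : isRep n Set.univ V₂ v₂)
    (hW : isRep n Set.univ W fun Φ x => u₁ Φ x * u₂ Φ x) :
    isRep n Set.univ W fun Φ x => v₁ Φ x * v₂ Φ x := by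
  refine hW.of_nullF_sub (hv₁.1.mul hv₂.1) ?_
  convert (NullF.mul_left hu₁.1 (hu₂.nullF_sub hv₂)).add
    (NullF.mul_left hv₂.1 (hu₁.nullF_sub hv₁)) using 3
  ring

lemma cptSupp.sub {R S : (𝔼 n → ℝ) → 𝔼 n → ℂ} (hR : cptSupp n Set.univ R)
    (hS : cptSupp n Set.univ S) : cptSupp n Set.univ fun Φ x => R Φ x - S Φ x := by
  obtain ⟨K, hK, -, hKR⟩ := hR
  obtain ⟨L, hL, -, hLS⟩ := hS
  refine ⟨K ∪ L, hK.union hL, Set.subset_univ _, fun Φ hΦ x hx => ?_⟩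
  simp only [hKR Φ hΦ x fun h => hx (.inl h), hLS Φ hΦ x fun h => hx (.inr h), sub_zero]

lemma cptSupp.mul_right {R : (𝔼 n → ℝ) → 𝔼 n → ℂ} (hR : cptSupp n Set.univ R)
    (S : (𝔼 n → ℝ) → 𝔼 n → ℂ) : cptSupp n Set.univ fun Φ x => R Φ x * S Φ x := by
  obtain ⟨K, hK, -, hKR⟩ := hR
  exact ⟨K, hK, Set.subset_univ _, fun Φ hΦ x hx => by simp only [hKR Φ hΦ x hx, zero_mul]⟩

lemma cptSupp.hasCompactSupport {R : (𝔼 n → ℝ) → 𝔼 n → ℂ} (hR : cptSupp n Set.univ R)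
    {Φ : 𝔼 n → ℝ} (hΦ : Φ ∈ Aset n 0) : HasCompactSupport (R Φ) := by
  obtain ⟨K, hK, -, hKR⟩ := hR
  exact HasCompactSupport.intro hK (hKR Φ hΦ)

end Representatives

section FourierBounds

variable {n : ℕ}

lemma EpsBound.fourier {R : (𝔼 n → ℝ) → 𝔼 n → ℂ}
    (hR : ∀ Φ ∈ Aset n 0, ContDiff ℝ (⊤ : ℕ∞) (R Φ)) {K : Set (𝔼 n)} (hK : IsCompact K)
    (hRK : ∀ Φ ∈ Aset n 0, ∀ x ∉ K, R Φ x = 0) {p : ℕ} {m : ℤ}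
    (h : ∀ k ∈ Finset.range (p + 1), EpsBound K (fun Ψ x => ‖iteratedFDeriv ℝ k (R Ψ) x‖) m) :
    EpsBound Set.univ (fun Ψ ξ => ‖FTC n Set.univ (R Ψ) ξ‖ * (1 + ‖ξ‖) ^ p) m := by
  obtain ⟨C, hC, hCb⟩ := exists_norm_FTC_mul_pow_le hK p
  have hs := EpsBound.sum (Finset.range (p + 1)) h
  refine hs.op hs fun c hc _ _ => ⟨C * c, by positivity, fun Ψ hΨ ε hε hb _ ξ _ => ?_⟩
  rw [mul_assoc]
  refine hCb (R Ψ) (hR Ψ hΨ) (hRK Ψ hΨ) _ (by positivity) (fun k hk x hx => ?_) ξ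
  exact (Finset.single_le_sum (f := fun k => ‖iteratedFDeriv ℝ k (R Ψ) x‖)
    (fun _ _ => norm_nonneg _) hk).trans (hb x hx)

lemma NullF.fourier {R : (𝔼 n → ℝ) → 𝔼 n → ℂ} (hR : NullF n Set.univ R)
    (hc : cptSupp n Set.univ R) (p q : ℕ) :
    EpsBound Set.univ (fun Ψ ξ => ‖FTC n Set.univ (R Ψ) ξ‖ * (1 + ‖ξ‖) ^ p) q := by
  rw [nullF_univ_iff] at hR
  obtain ⟨K, hK, -, hRK⟩ := hc
  exact EpsBound.fourier hR.1 hK hRK fun k _ => hR.2 K hK k q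

lemma Moderate.fourier {R : (𝔼 n → ℝ) → 𝔼 n → ℂ} (hR : Moderate n Set.univ R)
    (hc : cptSupp n Set.univ R) :
    ∃ N : ℕ, EpsBound Set.univ (fun Ψ ξ => ‖FTC n Set.univ (R Ψ) ξ‖) (-(N : ℤ)) := by
  rw [moderate_univ_iff] at hR
  obtain ⟨K, hK, -, hRK⟩ := hc
  obtain ⟨N, hN⟩ := hR.2 K hK 0
  refine ⟨N, ?_⟩
  simpa using EpsBound.fourier hR.1 hK hRK (p := 0) (m := -(N : ℤ)) (by simpa using hN)

lemma rapidDecOn_iff {R : (𝔼 n → ℝ) → 𝔼 n → ℂ} {Γ : Set (𝔼 n)} {N : ℕ} :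
    rapidDecOn n Set.univ R Γ N ↔ ∀ p : ℕ,
      EpsBound Γ (fun Ψ ξ => ‖FTC n Set.univ (R Ψ) ξ‖ * (1 + ‖ξ‖) ^ p) (-(N : ℤ)) := by
  have h : ∀ (p : ℕ) (ξ : 𝔼 n) (a b : ℝ),
      a ≤ b * (1 + ‖ξ‖) ^ (-(p : ℤ)) ↔ a * (1 + ‖ξ‖) ^ p ≤ b := fun p ξ a b => by
    rw [zpow_neg, zpow_natCast, ← div_eq_mul_inv, le_div_iff₀ (by positivity)]
  simp only [rapidDecOn, EpsBound, h]

lemma rapidDecOn.of_nullF_sub {R S : (𝔼 n → ℝ) → 𝔼 n → ℂ} {Γ : Set (𝔼 n)} {N : ℕ}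
    (h : rapidDecOn n Set.univ R Γ N) (hR : Moderate n Set.univ R) (hS : Moderate n Set.univ S)
    (hRc : cptSupp n Set.univ R) (hSc : cptSupp n Set.univ S)
    (hRS : NullF n Set.univ fun Φ x => R Φ x - S Φ x) : rapidDecOn n Set.univ S Γ N := by
  rw [rapidDecOn_iff] at h ⊢
  intro p
  have h' : EpsBound Γ _ (-(N : ℤ)) := ((hRS.fourier (hRc.sub hSc) p 0).of_le (T := Γ) one_pos
    fun Ψ _ ξ _ => ⟨ξ, trivial, (one_mul _).ge⟩).mono_exp (by simp)
  refine ((h p).add h').mono_le fun Ψ hΨ ξ _ => ?_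
  have hi : ∀ {T : (𝔼 n → ℝ) → 𝔼 n → ℂ}, Moderate n Set.univ T → cptSupp n Set.univ T →
      Integrable (T Ψ) := fun hT hTc =>
    ((moderate_univ_iff.1 hT).1 Ψ hΨ).continuous.integrable_of_hasCompactSupport
      (hTc.hasCompactSupport hΨ)
  rw [← add_mul, FTC_univ_sub (hi hR hRc) (hi hS hSc)]
  gcongr
  have := norm_sub_le (FTC n Set.univ (R Ψ) ξ)
    (FTC n Set.univ (R Ψ) ξ - FTC n Set.univ (S Ψ) ξ)
  rwa [sub_sub_cancel] at this

/-- The complement of `Σ_g` can be described by any compactly supported representative. -/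
lemma exists_rapidDecOn_of_notMem_SigmaG {U : GenF n Set.univ} {R : (𝔼 n → ℝ) → 𝔼 n → ℂ}
    (hR : isRep n Set.univ U R) (hRc : cptSupp n Set.univ R) {ξ : 𝔼 n} (h0 : ξ ≠ 0)
    (hξ : ξ ∉ SigmaG n Set.univ U) :
    ∃ Γ, IsOpenCone n Γ ∧ ξ ∈ Γ ∧ ∃ N : ℕ, rapidDecOn n Set.univ R Γ N := by
  have : ∃ R, isRep n Set.univ U R ∧ cptSupp n Set.univ R ∧
      ∃ Γ, IsOpenCone n Γ ∧ ξ ∈ Γ ∧ ∃ N : ℕ, rapidDecOn n Set.univ R Γ N := by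
    by_contra h
    exact hξ ⟨h0, h⟩
  obtain ⟨S, hS, hSc, Γ, hΓ, hξΓ, N, hN⟩ := this
  exact ⟨Γ, hΓ, hξΓ, N, hN.of_nullF_sub hS.1 hR.1 hSc hRc (hS.nullF_sub hR)⟩

lemma smul_mem_SigmaG {U : GenF n Set.univ} {ξ : 𝔼 n} (hξ : ξ ∈ SigmaG n Set.univ U) {t : ℝ}
    (ht : 0 < t) : t • ξ ∈ SigmaG n Set.univ U := by
  refine ⟨smul_ne_zero ht.ne' hξ.1, ?_⟩
  rintro ⟨R, hR, hRc, Γ, hΓ, hξΓ, hN⟩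
  refine hξ.2 ⟨R, hR, hRc, Γ, hΓ, ?_, hN⟩
  simpa [smul_smul, ht.ne'] using hΓ.2.2 _ hξΓ t⁻¹ (inv_pos.2 ht)

end FourierBounds

section Cones

variable {n : ℕ}

/-- In a conic neighborhood of a pair whose first component is a direction of rapid decrease,
the product of the Fourier transforms decreases rapidly in both variables. -/
lemma exists_conic_nhds_bound {f g : (𝔼 n → ℝ) → 𝔼 n → ℝ} {Γ : Set (𝔼 n)} {N₁ N₂ : ℕ}
    (hf : ∀ Ψ ξ, 0 ≤ f Ψ ξ) (hg : ∀ Ψ ξ, 0 ≤ g Ψ ξ) (hΓ : IsOpenCone n Γ)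
    (hfΓ : ∀ p : ℕ, EpsBound Γ (fun Ψ ξ => f Ψ ξ * (1 + ‖ξ‖) ^ p) (-(N₁ : ℤ)))
    (hgb : EpsBound Set.univ g (-(N₂ : ℤ))) {ζ : 𝔼 n} (hζ : ζ ∈ Γ) (η : 𝔼 n) :
    ∃ U : Set (𝔼 n × 𝔼 n), IsOpen U ∧ (∀ z ∈ U, ∀ t : ℝ, 0 < t → t • z ∈ U) ∧ (ζ, η) ∈ U ∧
      ∃ N : ℕ, ∀ p : ℕ,
        EpsBound U (fun Ψ z => f Ψ z.1 * g Ψ z.2 * (1 + ‖z‖) ^ p) (-(N : ℤ)) := by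
  have hζ0 : 0 < ‖ζ‖ := norm_pos_iff.2 fun h => hΓ.2.1 (h ▸ hζ)
  set C : ℝ := ‖η‖ / ‖ζ‖ + 1 with hC
  have hC1 : 1 ≤ C := by rw [hC]; linarith [div_nonneg (norm_nonneg η) hζ0.le]
  refine ⟨{z | z.1 ∈ Γ ∧ ‖z.2‖ < C * ‖z.1‖}, ?_, ?_, ?_, N₁ + N₂, fun p => ?_⟩
  · exact (hΓ.1.preimage continuous_fst).inter
      (isOpen_lt continuous_snd.norm (continuous_const.mul continuous_fst.norm))
  · rintro z ⟨h₁, h₂⟩ t ht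
    refine ⟨hΓ.2.2 _ h₁ t ht, ?_⟩
    simp only [Prod.smul_snd, Prod.smul_fst, norm_smul, Real.norm_of_nonneg ht.le]
    nlinarith
  · refine ⟨hζ, ?_⟩
    rw [hC, add_mul, div_mul_cancel₀ _ hζ0.ne']
    linarith
  · have h₁ : EpsBound {z : 𝔼 n × 𝔼 n | z.1 ∈ Γ ∧ ‖z.2‖ < C * ‖z.1‖}
        (fun Ψ z => f Ψ z.1 * (1 + ‖z.1‖) ^ p) (-(N₁ : ℤ)) :=
      (hfΓ p).of_le one_pos fun Ψ _ z hz => ⟨z.1, hz.1, (one_mul _).ge⟩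
    have h₂ : EpsBound {z : 𝔼 n × 𝔼 n | z.1 ∈ Γ ∧ ‖z.2‖ < C * ‖z.1‖}
        (fun Ψ z => g Ψ z.2) (-(N₂ : ℤ)) :=
      hgb.of_le one_pos fun Ψ _ z _ => ⟨z.2, trivial, (one_mul _).ge⟩
    refine ((h₁.mul h₂ fun Ψ _ z _ => ⟨mul_nonneg (hf _ _) (by positivity), hg _ _⟩).mono_exp
      (m₁ := -((N₁ + N₂ : ℕ) : ℤ)) (by push_cast; omega)).of_le (C := C ^ p) (by positivity)
      fun Ψ _ z hz => ⟨z, hz, ?_⟩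
    have hz' : 1 + ‖z‖ ≤ C * (1 + ‖z.1‖) := by
      have : ‖z‖ ≤ C * ‖z.1‖ := by
        rw [Prod.norm_def]
        exact max_le (le_mul_of_one_le_left (norm_nonneg _) hC1) hz.2.le
      linarith
    calc f Ψ z.1 * g Ψ z.2 * (1 + ‖z‖) ^ p
        ≤ f Ψ z.1 * g Ψ z.2 * (C * (1 + ‖z.1‖)) ^ p :=
          mul_le_mul_of_nonneg_left (pow_le_pow_left₀ (by positivity) hz' p)
            (mul_nonneg (hf _ _) (hg _ _))
      _ = _ := by rw [mul_pow]; ring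

/-- A conic open set containing all nonzero pairs with sum on the ray through `ξ₀` contains all
pairs with sum in a conic neighborhood of `ξ₀`. -/
lemma exists_open_cone_of_add_mem {E : Type*} [NormedAddCommGroup E] [NormedSpace ℝ E]
    [ProperSpace E] {U : Set (E × E)} (hU : IsOpen U)
    (hcone : ∀ z ∈ U, ∀ t : ℝ, 0 < t → t • z ∈ U) {ξ₀ : E} (hξ₀ : ξ₀ ≠ 0)
    (h : ∀ z : E × E, ‖z‖ = 1 → ‖ξ₀‖ • (z.1 + z.2) = ‖z.1 + z.2‖ • ξ₀ → z ∈ U) :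
    ∃ Γ : Set E, IsOpen Γ ∧ 0 ∉ Γ ∧ (∀ ξ ∈ Γ, ∀ t : ℝ, 0 < t → t • ξ ∈ Γ) ∧ ξ₀ ∈ Γ ∧
      ∀ z : E × E, z.1 + z.2 ∈ Γ → z ∈ U := by
  obtain ⟨d, hd⟩ : ∃ d : E → ℝ, ∀ ξ, d ξ = ‖‖ξ₀‖ • ξ - ‖ξ‖ • ξ₀‖ := ⟨_, fun _ => rfl⟩
  have hdc : Continuous d := by
    rw [funext hd]
    fun_prop
  have hds : ∀ t : ℝ, 0 < t → ∀ ξ, d (t • ξ) = t * d ξ := fun t ht ξ => by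
    rw [hd, hd, norm_smul, Real.norm_of_nonneg ht.le, mul_smul, smul_comm ‖ξ₀‖ t, ← smul_sub,
      norm_smul, Real.norm_of_nonneg ht.le]
  have hT : IsCompact (Metric.sphere (0 : E × E) 1 \ U) := (isCompact_sphere _ _).diff hU
  have hTpos : ∀ z ∈ Metric.sphere (0 : E × E) 1 \ U, 0 < d (z.1 + z.2) := fun z hz => by
    rw [hd]
    exact norm_pos_iff.2 fun h0 => hz.2 (h z (mem_sphere_zero_iff_norm.1 hz.1) (sub_eq_zero.1 h0))
  obtain ⟨δ, hδ, hδT⟩ := hT.exists_forall_le'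
    (hdc.comp (continuous_fst.add continuous_snd)).continuousOn hTpos
  refine ⟨{ξ | d ξ < δ / 2 * ‖ξ‖}, isOpen_lt hdc (continuous_const.mul continuous_norm), ?_,
    fun ξ hξ t ht => ?_, ?_, fun z hz => ?_⟩
  · simp [hd]
  · have hξ' : d ξ < δ / 2 * ‖ξ‖ := hξ
    change d (t • ξ) < δ / 2 * ‖t • ξ‖
    rw [hds t ht, norm_smul, Real.norm_of_nonneg ht.le, mul_left_comm]
    exact mul_lt_mul_of_pos_left hξ' ht
  · change d ξ₀ < δ / 2 * ‖ξ₀‖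
    rw [hd, sub_self, norm_zero]
    exact mul_pos (half_pos hδ) (norm_pos_iff.2 hξ₀)
  · have hz' : d (z.1 + z.2) < δ / 2 * ‖z.1 + z.2‖ := hz
    by_contra hzU
    have hz0 : 0 < ‖z‖ := by
      refine norm_pos_iff.2 fun h0 => ?_
      simp [h0, hd] at hz'
    have hm : ‖z‖⁻¹ • z ∈ Metric.sphere (0 : E × E) 1 \ U := by
      refine ⟨mem_sphere_zero_iff_norm.2 ?_, fun hmem => hzU ?_⟩
      · rw [norm_smul, norm_inv, norm_norm, inv_mul_cancel₀ hz0.ne']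
      · have := hcone _ hmem ‖z‖ hz0
        rwa [smul_smul, mul_inv_cancel₀ hz0.ne', one_smul] at this
    have h1 : δ ≤ d (‖z‖⁻¹ • (z.1 + z.2)) := by
      rw [smul_add]
      exact hδT _ hm
    rw [hds _ (inv_pos.2 hz0), inv_mul_eq_div, le_div_iff₀ hz0] at h1
    have h2 : ‖z.1 + z.2‖ ≤ 2 * ‖z‖ := by
      linarith [norm_add_le z.1 z.2, norm_fst_le z, norm_snd_le z]
    linarith [mul_le_mul_of_nonneg_left h2 (half_pos hδ).le]

/-- If for every pair of directions with sum on the ray through `ξ₀` one of the factors is rapidly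
decreasing, then the product of the Fourier transforms is rapidly decreasing in both variables on
the pairs with sum in a conic neighborhood of `ξ₀`. -/
lemma exists_isOpenCone_bound {f g : (𝔼 n → ℝ) → 𝔼 n → ℝ} {N₁ N₂ : ℕ}
    (hf : ∀ Ψ ξ, 0 ≤ f Ψ ξ) (hg : ∀ Ψ ξ, 0 ≤ g Ψ ξ)
    (hfb : EpsBound Set.univ f (-(N₁ : ℤ))) (hgb : EpsBound Set.univ g (-(N₂ : ℤ)))
    {ξ₀ : 𝔼 n} (hξ₀ : ξ₀ ≠ 0)
    (h : ∀ z : 𝔼 n × 𝔼 n, ‖z‖ = 1 → ‖ξ₀‖ • (z.1 + z.2) = ‖z.1 + z.2‖ • ξ₀ →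
      (∃ Γ, IsOpenCone n Γ ∧ z.1 ∈ Γ ∧ ∃ N : ℕ, ∀ p : ℕ,
        EpsBound Γ (fun Ψ ξ => f Ψ ξ * (1 + ‖ξ‖) ^ p) (-(N : ℤ))) ∨
      ∃ Γ, IsOpenCone n Γ ∧ z.2 ∈ Γ ∧ ∃ N : ℕ, ∀ p : ℕ,
        EpsBound Γ (fun Ψ ξ => g Ψ ξ * (1 + ‖ξ‖) ^ p) (-(N : ℤ))) :
    ∃ Γ, IsOpenCone n Γ ∧ ξ₀ ∈ Γ ∧ ∃ N : ℕ, ∀ p : ℕ,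
      EpsBound {z : 𝔼 n × 𝔼 n | z.1 + z.2 ∈ Γ}
        (fun Ψ z => f Ψ z.1 * g Ψ z.2 * (1 + ‖z‖) ^ p) (-(N : ℤ)) := by
  let P : Set (𝔼 n × 𝔼 n) → Prop := fun S => ∃ U : Set (𝔼 n × 𝔼 n), S ⊆ U ∧ IsOpen U ∧
    (∀ z ∈ U, ∀ t : ℝ, 0 < t → t • z ∈ U) ∧ ∃ N : ℕ, ∀ p : ℕ,
      EpsBound U (fun Ψ z => f Ψ z.1 * g Ψ z.2 * (1 + ‖z‖) ^ p) (-(N : ℤ))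
  have hK : IsCompact (Metric.sphere (0 : 𝔼 n × 𝔼 n) 1 ∩
      {z | ‖ξ₀‖ • (z.1 + z.2) = ‖z.1 + z.2‖ • ξ₀}) :=
    (isCompact_sphere _ _).inter_right (isClosed_eq (by fun_prop) (by fun_prop))
  have hP : P (Metric.sphere (0 : 𝔼 n × 𝔼 n) 1 ∩
      {z | ‖ξ₀‖ • (z.1 + z.2) = ‖z.1 + z.2‖ • ξ₀}) := by
    refine hK.induction_on ?_ ?_ ?_ ?_
    · exact ⟨∅, Set.empty_subset _, isOpen_empty, by simp, 0, fun p =>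
        EpsBound.of_nonpos fun _ _ _ hx => hx.elim⟩
    · rintro S T hST ⟨U, hTU, hU⟩
      exact ⟨U, hST.trans hTU, hU⟩
    · rintro S T ⟨U, hSU, hU, hUc, N, hN⟩ ⟨V, hTV, hV, hVc, M, hM⟩
      refine ⟨U ∪ V, Set.union_subset_union hSU hTV, hU.union hV, ?_, N + M, fun p =>
        ((hN p).mono_exp (by push_cast; omega)).union ((hM p).mono_exp (by push_cast; omega))⟩
      rintro z (hz | hz) t ht
      exacts [.inl (hUc z hz t ht), .inr (hVc z hz t ht)]
    · rintro z ⟨hz1, hz⟩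
      suffices ∃ U : Set (𝔼 n × 𝔼 n), IsOpen U ∧ (∀ z ∈ U, ∀ t : ℝ, 0 < t → t • z ∈ U) ∧
          z ∈ U ∧ ∃ N : ℕ, ∀ p : ℕ,
            EpsBound U (fun Ψ z => f Ψ z.1 * g Ψ z.2 * (1 + ‖z‖) ^ p) (-(N : ℤ)) by
        obtain ⟨U, hU, hUc, hzU, hN⟩ := this
        exact ⟨U, mem_nhdsWithin_of_mem_nhds (hU.mem_nhds hzU), U, subset_rfl, hU, hUc, hN⟩
      rcases h z (by simpa using hz1) hz with ⟨Γ, hΓ, hzΓ, N, hN⟩ | ⟨Γ, hΓ, hzΓ, N, hN⟩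
      · exact exists_conic_nhds_bound hf hg hΓ hN hgb hzΓ z.2
      · obtain ⟨U, hU, hUc, hzU, M, hM⟩ := exists_conic_nhds_bound hg hf hΓ hN hfb hzΓ z.1
        refine ⟨Prod.swap ⁻¹' U, hU.preimage continuous_swap, fun w hw t ht => hUc _ hw t ht,
          hzU, M, fun p => (hM p).of_le one_pos fun Ψ _ w hw => ⟨w.swap, hw, ?_⟩⟩
        simp only [Prod.fst_swap, Prod.snd_swap, Prod.norm_def, one_mul, max_comm ‖w.2‖,
          mul_comm (g Ψ w.2), le_refl]
  obtain ⟨U, hKU, hU, hUc, N, hN⟩ := hP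
  obtain ⟨Γ, hΓo, hΓ0, hΓc, hξΓ, hΓU⟩ := exists_open_cone_of_add_mem hU hUc hξ₀ fun z hz hz' =>
    hKU ⟨by simpa using hz, hz'⟩
  exact ⟨Γ, ⟨hΓo, hΓ0, hΓc⟩, hξΓ, N, fun p => (hN p).of_le one_pos fun Ψ _ z hz =>
    ⟨z, hΓU z hz, (one_mul _).ge⟩⟩

lemma integrable_one_add_norm_pow_inv :
    Integrable fun η : 𝔼 n => ((1 + ‖η‖) ^ (n + 1))⁻¹ := by
  have := integrable_one_add_norm (E := 𝔼 n) (μ := volume) (r := (n + 1 : ℕ)) (by simp)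
  refine this.congr (Filter.Eventually.of_forall fun η => ?_)
  beta_reduce
  rw [Real.rpow_neg (by positivity), Real.rpow_natCast]

/-- Rapid decrease of the Fourier transform of a product, from joint rapid decrease of the
product of the Fourier transforms. -/
lemma rapidDecOn_mul {R S : (𝔼 n → ℝ) → 𝔼 n → ℂ} (hR : Moderate n Set.univ R)
    (hS : Moderate n Set.univ S) (hRc : cptSupp n Set.univ R) (hSc : cptSupp n Set.univ S)
    {Γ : Set (𝔼 n)} {N : ℕ}
    (h : ∀ p : ℕ, EpsBound {z : 𝔼 n × 𝔼 n | z.1 + z.2 ∈ Γ}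
      (fun Ψ z => ‖FTC n Set.univ (R Ψ) z.1‖ * ‖FTC n Set.univ (S Ψ) z.2‖ * (1 + ‖z‖) ^ p)
      (-(N : ℤ))) :
    rapidDecOn n Set.univ (fun Φ x => R Φ x * S Φ x) Γ N := by
  rw [rapidDecOn_iff]
  intro p
  have hp := h (p + (n + 1))
  set I : ℝ := ∫ η : 𝔼 n, ((1 + ‖η‖) ^ (n + 1))⁻¹
  have hI : 0 ≤ I := integral_nonneg fun η => by positivity
  refine hp.op hp fun c hc _ _ => ⟨2 ^ p * c * I + 1, by positivity, fun Ψ hΨ ε hε hb _ ξ hξ => ?_⟩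
  have hεN : 0 < ε ^ (-(N : ℤ)) := by positivity
  have hpt : ∀ η : 𝔼 n, ‖FTC n Set.univ (R Ψ) (ξ + (2 * Real.pi) • η)‖ *
      ‖FTC n Set.univ (S Ψ) (-((2 * Real.pi) • η))‖ ≤
      2 ^ p * c * ε ^ (-(N : ℤ)) * ((1 + ‖ξ‖) ^ p)⁻¹ * ((1 + ‖η‖) ^ (n + 1))⁻¹ := fun η => by
    set z : 𝔼 n × 𝔼 n := (ξ + (2 * Real.pi) • η, -((2 * Real.pi) • η)) with hz
    have hzs : z.1 + z.2 = ξ := by simp [hz]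
    have hbz := hb z (by simpa only [Set.mem_ofPred_eq, hzs] using hξ)
    have hξz : 1 + ‖ξ‖ ≤ 2 * (1 + ‖z‖) := by
      have := norm_add_le z.1 z.2
      rw [hzs] at this
      linarith [norm_fst_le z, norm_snd_le z]
    have hηz : 1 + ‖η‖ ≤ 1 + ‖z‖ := by
      have h1 : ‖z.2‖ = 2 * Real.pi * ‖η‖ := by
        simp [hz, norm_smul, abs_of_pos Real.pi_pos]
      have h2 : ‖η‖ ≤ 2 * Real.pi * ‖η‖ :=
        le_mul_of_one_le_left (norm_nonneg _) (by linarith [Real.pi_gt_three])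
      linarith [norm_snd_le z]
    have hw : (1 + ‖ξ‖) ^ p * (1 + ‖η‖) ^ (n + 1) ≤ 2 ^ p * (1 + ‖z‖) ^ (p + (n + 1)) := by
      rw [pow_add (1 + ‖z‖) p, ← mul_assoc, ← mul_pow]
      gcongr
    rw [mul_assoc (_ * _ * _), ← mul_inv, ← div_eq_mul_inv, le_div_iff₀ (by positivity)]
    calc _ ≤ ‖FTC n Set.univ (R Ψ) z.1‖ * ‖FTC n Set.univ (S Ψ) z.2‖ *
          (2 ^ p * (1 + ‖z‖) ^ (p + (n + 1))) := by gcongr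
      _ = 2 ^ p * (‖FTC n Set.univ (R Ψ) z.1‖ * ‖FTC n Set.univ (S Ψ) z.2‖ *
          (1 + ‖z‖) ^ (p + (n + 1))) := by ring
      _ ≤ 2 ^ p * (c * ε ^ (-(N : ℤ))) := by gcongr
      _ = _ := by ring
  have hle : ‖FTC n Set.univ (fun x => R Ψ x * S Ψ x) ξ‖ ≤
      2 ^ p * c * ε ^ (-(N : ℤ)) * ((1 + ‖ξ‖) ^ p)⁻¹ * I := by
    refine (norm_FTC_mul_le ((moderate_univ_iff.1 hR).1 Ψ hΨ) (hRc.hasCompactSupport hΨ)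
      ((moderate_univ_iff.1 hS).1 Ψ hΨ) (hSc.hasCompactSupport hΨ) ξ).trans ?_
    rw [← integral_const_mul]
    exact integral_mono_of_nonneg (Filter.Eventually.of_forall fun η => by positivity)
      (integrable_one_add_norm_pow_inv.const_mul _) (Filter.Eventually.of_forall hpt)
  calc _ ≤ 2 ^ p * c * ε ^ (-(N : ℤ)) * ((1 + ‖ξ‖) ^ p)⁻¹ * I * (1 + ‖ξ‖) ^ p := by gcongr
    _ = 2 ^ p * c * I * ε ^ (-(N : ℤ)) := by
      have : (1 + ‖ξ‖) ^ p ≠ 0 := by positivity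
      field_simp
    _ ≤ _ := by gcongr; linarith

/-- A pair with sum on the ray through a point outside the right-hand side of the inclusion has a
nonzero component outside the corresponding cone. -/
lemma ne_zero_and_notMem_SigmaG_or {V₁ V₂ : GenF n Set.univ}
    (hfav : (0 : 𝔼 n) ∉ SigmaG n Set.univ V₁ + SigmaG n Set.univ V₂) {ξ₀ : 𝔼 n} (hξ₀ : ξ₀ ≠ 0)
    (h₁₂ : ξ₀ ∉ SigmaG n Set.univ V₁ + SigmaG n Set.univ V₂) (h₁ : ξ₀ ∉ SigmaG n Set.univ V₁)
    (h₂ : ξ₀ ∉ SigmaG n Set.univ V₂) {z : 𝔼 n × 𝔼 n} (hz : ‖z‖ = 1)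
    (hray : ‖ξ₀‖ • (z.1 + z.2) = ‖z.1 + z.2‖ • ξ₀) :
    (z.1 ≠ 0 ∧ z.1 ∉ SigmaG n Set.univ V₁) ∨ (z.2 ≠ 0 ∧ z.2 ∉ SigmaG n Set.univ V₂) := by
  have hξpos : 0 < ‖ξ₀‖ := norm_pos_iff.2 hξ₀
  have hray' : ∀ w : 𝔼 n, w ≠ 0 → ‖ξ₀‖ • w = ‖w‖ • ξ₀ → ξ₀ = (‖w‖⁻¹ * ‖ξ₀‖) • w :=
    fun w hw h => by
      rw [mul_smul, h, smul_smul, inv_mul_cancel₀ (norm_ne_zero_iff.2 hw), one_smul]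
  have hpos : ∀ w : 𝔼 n, w ≠ 0 → 0 < ‖w‖⁻¹ * ‖ξ₀‖ := fun w hw =>
    mul_pos (inv_pos.2 (norm_pos_iff.2 hw)) hξpos
  by_cases hz1 : z.1 = 0
  · have hz2 : z.2 ≠ 0 := fun h => by
      rw [show z = 0 from Prod.ext hz1 h, norm_zero] at hz
      exact zero_ne_one hz
    refine .inr ⟨hz2, fun hmem => h₂ ?_⟩
    rw [hz1, zero_add] at hray
    rw [hray' _ hz2 hray]
    exact smul_mem_SigmaG hmem (hpos _ hz2)
  by_cases hz2 : z.2 = 0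
  · refine .inl ⟨hz1, fun hmem => h₁ ?_⟩
    rw [hz2, add_zero] at hray
    rw [hray' _ hz1 hray]
    exact smul_mem_SigmaG hmem (hpos _ hz1)
  by_contra! hcon
  have hm₁ := hcon.1 hz1
  have hm₂ := hcon.2 hz2
  have hs : z.1 + z.2 ≠ 0 := fun h => hfav (h ▸ Set.add_mem_add hm₁ hm₂)
  refine h₁₂ ?_
  rw [hray' _ hs hray, smul_add]
  exact Set.add_mem_add (smul_mem_SigmaG hm₁ (hpos _ hs)) (smul_mem_SigmaG hm₂ (hpos _ hs))

end Cones

/--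
**Proposition 3.4.** Let `V₁, V₂ ∈ 𝒢_c(ℝⁿ)` with
`0 ∉ Σ_g(V₁) + Σ_g(V₂)`. Then
`Σ_g(V₁V₂) ⊆ (Σ_g(V₁) + Σ_g(V₂)) ∪ Σ_g(V₁) ∪ Σ_g(V₂)`, where the product `V₁V₂` is
induced by pointwise multiplication of representatives.
-/
theorem stmt7 (n : ℕ) (V₁ V₂ : GenF n (Set.univ : Set (EuclideanSpace ℝ (Fin n))))
    (h₁ : cptClass n Set.univ V₁) (h₂ : cptClass n Set.univ V₂)
    (hfav : (0 : EuclideanSpace ℝ (Fin n)) ∉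
      SigmaG n Set.univ V₁ + SigmaG n Set.univ V₂)
    (u₁ u₂ : (EuclideanSpace ℝ (Fin n) → ℝ) → EuclideanSpace ℝ (Fin n) → ℂ)
    (hu₁ : isRep n Set.univ V₁ u₁) (hu₂ : isRep n Set.univ V₂ u₂)
    (W : GenF n (Set.univ : Set (EuclideanSpace ℝ (Fin n))))
    (hW : isRep n Set.univ W (fun Φ x => u₁ Φ x * u₂ Φ x)) :
    SigmaG n Set.univ W ⊆
      (SigmaG n Set.univ V₁ + SigmaG n Set.univ V₂) ∪
        SigmaG n Set.univ V₁ ∪ SigmaG n Set.univ V₂ := by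
  intro ξ₀ hξ₀
  by_contra hcon
  simp only [Set.mem_union, not_or] at hcon
  obtain ⟨⟨h₁₂, hV₁⟩, hV₂⟩ := hcon
  obtain ⟨v₁, hv₁, hc₁⟩ := h₁
  obtain ⟨v₂, hv₂, hc₂⟩ := h₂
  obtain ⟨N₁, hN₁⟩ := hv₁.1.fourier hc₁
  obtain ⟨N₂, hN₂⟩ := hv₂.1.fourier hc₂
  obtain ⟨Γ, hΓ, hξΓ, N, hN⟩ := exists_isOpenCone_bound (fun _ _ => norm_nonneg _)
    (fun _ _ => norm_nonneg _) hN₁ hN₂ hξ₀.1 fun z hz hray => by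
      simp only [← rapidDecOn_iff]
      exact (ne_zero_and_notMem_SigmaG_or hfav hξ₀.1 h₁₂ hV₁ hV₂ hz hray).imp
        (fun h => exists_rapidDecOn_of_notMem_SigmaG hv₁ hc₁ h.1 h.2)
        (fun h => exists_rapidDecOn_of_notMem_SigmaG hv₂ hc₂ h.1 h.2)
  exact hξ₀.2 ⟨fun Φ x => v₁ Φ x * v₂ Φ x, hu₁.mul_congr hu₂ hv₁ hv₂ hW, hc₁.mul_right v₂, Γ, hΓ,
    hξΓ, N, rapidDecOn_mul hv₁.1 hv₂.1 hc₁ hc₂ hN⟩
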